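/- arXiv:math/0407218 — 2 statements merged into one kernel-verified Lean document; each statement's English description precedes it below -/
import Mathlib

section
/- The map φ sending a colored ribbon (c,D) to (c,D′), where D′ is the symmetric difference of D and the set {i ∈ {1,…,n−1} : c_i ≠ c_{i+1}}, is an involution on the set of colored ribbons of size n, and it restricts to a bijection from the set of cycloribbons of size n onto the set of anticycloribbons of size n. -/
namespace Cyclo

/-- The position `i` of `Fin (n-1)`, viewed in `Fin n`. -/
def idx0 (n : ℕ) (i : Fin (n - 1)) : Fin n := ⟨i.1, by have := i.2; omega⟩

/-- The position `i+1` of `Fin n`, for `i : Fin (n-1)`. -/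
def idx1 (n : ℕ) (i : Fin (n - 1)) : Fin n := ⟨i.1 + 1, by have := i.2; omega⟩

/-- A colored ribbon of size `n` with colors in `{1,…,r}` is encoded as a pair
`(c, D)` with `c : Fin n → Fin r` and `D ⊆ Fin (n-1)` the descent set of the
underlying composition (`i ∈ D` means cell `i+1` lies below cell `i`). -/
abbrev ColoredRibbon (n r : ℕ) : Type := (Fin n → Fin r) × Finset (Fin (n - 1))

/-- Cycloribbon: weakly increasing in rows, weakly decreasing in columns. -/
def IsCycloribbon (n r : ℕ) (p : ColoredRibbon n r) : Prop :=
  ∀ i : Fin (n - 1),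
    (i ∉ p.2 → p.1 (idx0 n i) ≤ p.1 (idx1 n i)) ∧
    (i ∈ p.2 → p.1 (idx1 n i) ≤ p.1 (idx0 n i))

/-- Anticycloribbon: weakly decreasing in rows, weakly increasing in columns. -/
def IsAnticycloribbon (n r : ℕ) (p : ColoredRibbon n r) : Prop :=
  ∀ i : Fin (n - 1),
    (i ∉ p.2 → p.1 (idx1 n i) ≤ p.1 (idx0 n i)) ∧
    (i ∈ p.2 → p.1 (idx0 n i) ≤ p.1 (idx1 n i))

/-- The involution `φ`: keep the colors, and take the symmetric difference of the
descent set with the set of positions where the color changes. -/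
def phi (n r : ℕ) (p : ColoredRibbon n r) : ColoredRibbon n r :=
  (p.1, symmDiff p.2 (Finset.univ.filter fun i : Fin (n - 1) => p.1 (idx0 n i) ≠ p.1 (idx1 n i)))

end Cyclo

namespace Cyclo

theorem phi_phi (n r : ℕ) (p : ColoredRibbon n r) : phi n r (phi n r p) = p :=
  Prod.ext rfl (symmDiff_symmDiff_cancel_right _ _)

theorem mem_phi_snd (n r : ℕ) (p : ColoredRibbon n r) (i : Fin (n - 1)) :
    i ∈ (phi n r p).2 ↔ (i ∈ p.2 ↔ p.1 (idx0 n i) = p.1 (idx1 n i)) := by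
  simp only [phi, Finset.mem_symmDiff, Finset.mem_filter, Finset.mem_univ, true_and]
  tauto

theorem isAnticycloribbon_phi_iff (n r : ℕ) (p : ColoredRibbon n r) :
    IsAnticycloribbon n r (phi n r p) ↔ IsCycloribbon n r p := by
  refine forall_congr' fun i => ?_
  rw [mem_phi_snd]
  change ((_ → p.1 _ ≤ p.1 _) ∧ (_ → p.1 _ ≤ p.1 _)) ↔ _
  by_cases hi : i ∈ p.2 <;> by_cases h : p.1 (idx0 n i) = p.1 (idx1 n i) <;> simp [hi, h]

/-- `φ` is an involution on colored ribbons of size `n`, and it restricts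
to a bijection from the set of cycloribbons onto the set of anticycloribbons. -/
theorem phi_involution_bijOn (n r : ℕ) (hn : 1 ≤ n) (hr : 1 ≤ r) :
    (∀ p : ColoredRibbon n r, phi n r (phi n r p) = p) ∧
      Set.BijOn (phi n r) {p | IsCycloribbon n r p} {p | IsAnticycloribbon n r p} := by
  refine ⟨phi_phi n r, fun p hp => (isAnticycloribbon_phi_iff n r p).2 hp,
    (Function.Involutive.injective (phi_phi n r)).injOn, fun p hp => ⟨phi n r p, ?_, phi_phi n r p⟩⟩
  change IsCycloribbon n r (phi n r p)
  rw [← isAnticycloribbon_phi_iff, phi_phi]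
  exact hp

end Cyclo
end

section
/- The subalgebra of H_{n,r}(0) generated by T_1,…,T_{n−1} is isomorphic to the 0-Hecke algebra H_n(0) (in particular it has dimension n! over ℂ), and H_{n,r}(0) is free as a right module over this subalgebra, with basis { L_c : c ∈ C^n }; in particular it has rank r^n. -/
noncomputable section

open Polynomial

namespace AKS0

/-- Generators: `Sum.inl i` is `T_{i+1}` (0-indexed `T_i`, acting on positions `i, i+1`),
`Sum.inr j` is `ξ_{j+1}` (0-indexed `ξ_j`). -/
abbrev Gen (n : ℕ) : Type := Fin (n - 1) ⊕ Fin n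

abbrev FreeAKS (n : ℕ) : Type := FreeAlgebra ℂ (Gen n)

def tGen (n : ℕ) (i : Fin (n - 1)) : FreeAKS n := FreeAlgebra.ι ℂ (Sum.inl i)

def xGen (n : ℕ) (j : Fin n) : FreeAKS n := FreeAlgebra.ι ℂ (Sum.inr j)

/-- The position `i` of `Fin (n-1)`, viewed in `Fin n`. -/
def idx0 (n : ℕ) (i : Fin (n - 1)) : Fin n := ⟨i.1, by have := i.2; omega⟩

/-- The position `i+1` of `Fin n`, for `i : Fin (n-1)`. -/
def idx1 (n : ℕ) (i : Fin (n - 1)) : Fin n := ⟨i.1 + 1, by have := i.2; omega⟩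

/-- The Lagrange polynomial `P_k(X) = ∏_{l ≠ k} (X - u_l)/(u_k - u_l)`. -/
def lagPoly (r : ℕ) (u : Fin r → ℂ) (k : Fin r) : ℂ[X] :=
  ∏ l ∈ Finset.univ.erase k, (C ((u k - u l)⁻¹) * (X - C (u l)))

/-- The defining relations of the Ariki-Koike-Shoji algebra `H_{n,r}(q)`. -/
inductive Rel (n r : ℕ) (u : Fin r → ℂ) (q : ℂ) : FreeAKS n → FreeAKS n → Prop
  | quad (i : Fin (n - 1)) :
      Rel n r u q ((tGen n i - algebraMap ℂ (FreeAKS n) q) * (tGen n i + 1)) 0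
  | braid (i j : Fin (n - 1)) (h : (j : ℕ) = (i : ℕ) + 1) :
      Rel n r u q (tGen n i * tGen n j * tGen n i) (tGen n j * tGen n i * tGen n j)
  | commTT (i j : Fin (n - 1)) (h : (i : ℕ) + 2 ≤ (j : ℕ) ∨ (j : ℕ) + 2 ≤ (i : ℕ)) :
      Rel n r u q (tGen n i * tGen n j) (tGen n j * tGen n i)
  | xPoly (j : Fin n) :
      Rel n r u q (Polynomial.aeval (xGen n j) (∏ l : Fin r, (X - C (u l)))) 0
  | commXX (i j : Fin n) :
      Rel n r u q (xGen n i * xGen n j) (xGen n j * xGen n i)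
  | cross (i : Fin (n - 1)) :
      Rel n r u q (tGen n i * xGen n (idx0 n i))
        (xGen n (idx1 n i) * tGen n i -
          (q - 1) • ∑ p ∈ Finset.univ.filter (fun p : Fin r × Fin r => p.1 < p.2),
            (u p.2 - u p.1) •
              (Polynomial.aeval (xGen n (idx0 n i)) (lagPoly r u p.1) *
                Polynomial.aeval (xGen n (idx1 n i)) (lagPoly r u p.2)))
  | sumComm (i : Fin (n - 1)) :
      Rel n r u q (tGen n i * (xGen n (idx1 n i) + xGen n (idx0 n i)))
        ((xGen n (idx1 n i) + xGen n (idx0 n i)) * tGen n i)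
  | commTX (i : Fin (n - 1)) (j : Fin n) (h : j ≠ idx0 n i) (h' : j ≠ idx1 n i) :
      Rel n r u q (tGen n i * xGen n j) (xGen n j * tGen n i)

/-- The Ariki-Koike-Shoji algebra `H_{n,r}(q)` (Shoji's presentation, normalized). -/
abbrev AKSAlg (n r : ℕ) (u : Fin r → ℂ) (q : ℂ) : Type := RingQuot (Rel n r u q)

/-- The generator `T_i` in `H_{n,r}(q)`. -/
def Ti (n r : ℕ) (u : Fin r → ℂ) (q : ℂ) (i : Fin (n - 1)) : AKSAlg n r u q :=
  RingQuot.mkAlgHom ℂ (Rel n r u q) (tGen n i)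

/-- The generator `ξ_j` in `H_{n,r}(q)`. -/
def Xi (n r : ℕ) (u : Fin r → ℂ) (q : ℂ) (j : Fin n) : AKSAlg n r u q :=
  RingQuot.mkAlgHom ℂ (Rel n r u q) (xGen n j)

/-- `L_c = P_{c_1}(ξ_1) ⋯ P_{c_n}(ξ_n)`. -/
def Lc (n r : ℕ) (u : Fin r → ℂ) (q : ℂ) (c : Fin n → Fin r) : AKSAlg n r u q :=
  (List.ofFn fun j : Fin n => Polynomial.aeval (Xi n r u q j) (lagPoly r u (c j))).prod

end AKS0

namespace AKS0

/-- The defining relations of the 0-Hecke algebra `H_n(0)`. -/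
inductive HeckeRel (n : ℕ) :
    FreeAlgebra ℂ (Fin (n - 1)) → FreeAlgebra ℂ (Fin (n - 1)) → Prop
  | quad (i : Fin (n - 1)) :
      HeckeRel n (FreeAlgebra.ι ℂ i * (FreeAlgebra.ι ℂ i + 1)) 0
  | braid (i j : Fin (n - 1)) (h : (j : ℕ) = (i : ℕ) + 1) :
      HeckeRel n (FreeAlgebra.ι ℂ i * FreeAlgebra.ι ℂ j * FreeAlgebra.ι ℂ i)
        (FreeAlgebra.ι ℂ j * FreeAlgebra.ι ℂ i * FreeAlgebra.ι ℂ j)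
  | commTT (i j : Fin (n - 1)) (h : (i : ℕ) + 2 ≤ (j : ℕ) ∨ (j : ℕ) + 2 ≤ (i : ℕ)) :
      HeckeRel n (FreeAlgebra.ι ℂ i * FreeAlgebra.ι ℂ j)
        (FreeAlgebra.ι ℂ j * FreeAlgebra.ι ℂ i)

/-- The 0-Hecke algebra `H_n(0)`. -/
abbrev Hecke (n : ℕ) : Type := RingQuot (HeckeRel n)

/-- The generator `T_i` of the 0-Hecke algebra. -/
def hT (n : ℕ) (i : Fin (n - 1)) : Hecke n :=
  RingQuot.mkAlgHom ℂ (HeckeRel n) (FreeAlgebra.ι ℂ i)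

section Representation

lemma braid_three_letters {A α : Type*} [Ring A] [LinearOrder α] (s t : A) (hs : s * (s + 1) = 0)
    (ht : t * (t + 1) = 0) (hst : s * t * s = t * s * t) (U V : (α → α → α → A) → α → α → α → A)
    (hU : ∀ g a b d, U g a b d = s * g b a d + if a < b then g b a d - g a b d else 0)
    (hV : ∀ g a b d, V g a b d = t * g a d b + if b < d then g a d b - g a b d else 0)
    (g : α → α → α → A) (a b d : α) : U (V (U g)) a b d = V (U (V g)) a b d := by
  have hs' (x : A) : s * (s * x) = -(s * x) := by
    rw [← mul_assoc, eq_neg_iff_add_eq_zero, ← add_mul, ← mul_add_one, hs, zero_mul]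
  have ht' (x : A) : t * (t * x) = -(t * x) := by
    rw [← mul_assoc, eq_neg_iff_add_eq_zero, ← add_mul, ← mul_add_one, ht, zero_mul]
  have hst' (x : A) : s * (t * (s * x)) = t * (s * (t * x)) := by
    simp only [← mul_assoc, hst]
  simp only [hU, hV]
  clear hU hV hs ht hst
  rcases lt_trichotomy a b with hab | rfl | hab
  · have := hab.not_gt
    rcases lt_trichotomy b d with hbd | rfl | hbd
    · have := hbd.not_gt
      have had := hab.trans hbd
      have := had.not_gt
      simp only [*, if_true, if_false, mul_add, mul_sub, add_zero]
      abel
    · simp only [*, lt_irrefl, if_true, if_false, mul_add, mul_sub, add_zero]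
      abel
    · have := hbd.not_gt
      rcases lt_trichotomy a d with had | rfl | had
      · have := had.not_gt
        simp only [*, if_true, if_false, mul_add, mul_sub, add_zero]
        abel
      · simp only [*, lt_irrefl, if_true, if_false, mul_add, mul_sub, add_zero]
      · have := had.not_gt
        simp only [*, if_true, if_false, mul_add, mul_sub, add_zero]
  · rcases lt_trichotomy a d with had | rfl | had
    · have := had.not_gt
      simp only [*, lt_irrefl, if_true, if_false, mul_add, mul_sub, add_zero]
      abel
    · simp only [*, lt_irrefl, if_false, add_zero]
    · have := had.not_gt
      simp only [*, lt_irrefl, if_true, if_false, add_zero]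
  · have := hab.not_gt
    rcases lt_trichotomy b d with hbd | rfl | hbd
    · have := hbd.not_gt
      rcases lt_trichotomy a d with had | rfl | had
      · have := had.not_gt
        simp only [*, if_true, if_false, mul_add, mul_sub, add_zero]
        abel
      · simp only [*, lt_irrefl, if_true, if_false, mul_add, mul_sub, add_zero]
      · have := had.not_gt
        simp only [*, if_true, if_false, mul_add, mul_sub, add_zero]
    · simp only [*, lt_irrefl, if_true, if_false, add_zero]
    · have := hbd.not_gt
      have had := hbd.trans hab
      have := had.not_gt
      simp only [*, if_false, add_zero]

variable {n r : ℕ}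

/-- The word `c` with the letters at positions `i` and `i + 1` exchanged. -/
def swapWord (i : Fin (n - 1)) (c : Fin n → Fin r) : Fin n → Fin r :=
  c ∘ Equiv.swap (idx0 n i) (idx1 n i)

lemma idx0_ne_idx1 (i : Fin (n - 1)) : idx0 n i ≠ idx1 n i := by
  simp [idx0, idx1, Fin.ext_iff]

@[simp] lemma swapWord_idx0 (i : Fin (n - 1)) (c : Fin n → Fin r) :
    swapWord i c (idx0 n i) = c (idx1 n i) := by simp [swapWord]

@[simp] lemma swapWord_idx1 (i : Fin (n - 1)) (c : Fin n → Fin r) :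
    swapWord i c (idx1 n i) = c (idx0 n i) := by simp [swapWord]

lemma swapWord_of_ne (i : Fin (n - 1)) (c : Fin n → Fin r) {j : Fin n}
    (h : j ≠ idx0 n i) (h' : j ≠ idx1 n i) : swapWord i c j = c j := by
  simp [swapWord, Equiv.swap_apply_of_ne_of_ne h h']

@[simp] lemma swapWord_swapWord (i : Fin (n - 1)) (c : Fin n → Fin r) :
    swapWord i (swapWord i c) = c := by
  ext j; simp [swapWord]

lemma swapWord_eq_self (i : Fin (n - 1)) (c : Fin n → Fin r)
    (h : c (idx0 n i) = c (idx1 n i)) : swapWord i c = c := by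
  funext j
  by_cases h0 : j = idx0 n i
  · subst h0; simp [h]
  by_cases h1 : j = idx1 n i
  · subst h1; simp [h]
  exact swapWord_of_ne i c h0 h1

variable {A : Type*} [Ring A] [Algebra ℂ A]

/-- The operator by which `T_i` acts on `A`-valued functions on color words, `t` being the image
of `T_i` in `A`. -/
def tOp (t : A) (i : Fin (n - 1)) : Module.End ℂ ((Fin n → Fin r) → A) where
  toFun φ c := t * φ (swapWord i c) +
    if c (idx0 n i) < c (idx1 n i) then φ (swapWord i c) - φ c else 0
  map_add' φ ψ := by
    funext c
    simp only [Pi.add_apply]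
    split_ifs <;> noncomm_ring
  map_smul' a φ := by
    funext c
    simp only [Pi.smul_apply, RingHom.id_apply]
    split_ifs <;> simp [smul_add, smul_sub]

lemma tOp_apply (t : A) (i : Fin (n - 1)) (φ : (Fin n → Fin r) → A) (c : Fin n → Fin r) :
    tOp t i φ c = t * φ (swapWord i c) +
      if c (idx0 n i) < c (idx1 n i) then φ (swapWord i c) - φ c else 0 := rfl

lemma tOp_const (t : A) (i : Fin (n - 1)) (x : A) :
    tOp (r := r) t i (fun _ => x) = fun _ => t * x := by
  funext c; simp [tOp_apply]

lemma tOp_quad (t : A) (i : Fin (n - 1)) (ht : t * (t + 1) = 0) :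
    tOp (r := r) t i * (tOp t i + 1) = 0 := by
  have ht' (x : A) : t * (t * x) = -(t * x) := by
    rw [← mul_assoc, eq_neg_iff_add_eq_zero, ← add_mul, ← mul_add_one, ht, zero_mul]
  refine LinearMap.ext fun φ => ?_
  funext c
  simp only [Module.End.mul_apply, LinearMap.add_apply, Module.End.one_apply,
    LinearMap.zero_apply, Pi.zero_apply, tOp_apply, Pi.add_apply, swapWord_swapWord,
    swapWord_idx0, swapWord_idx1]
  rcases lt_trichotomy (c (idx0 n i)) (c (idx1 n i)) with h | h | h
  · simp only [h, h.not_gt, if_true, if_false, mul_add, mul_zero, ht']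
    abel
  · simp only [h, lt_irrefl, if_false, mul_add, mul_zero, ht', swapWord_eq_self i c h]
    abel
  · simp only [h, h.not_gt, if_true, if_false, mul_add, mul_sub, ht']
    abel

lemma tOp_braid (s t : A) (i j : Fin (n - 1)) (hij : (j : ℕ) = (i : ℕ) + 1)
    (hs : s * (s + 1) = 0) (ht : t * (t + 1) = 0) (hst : s * t * s = t * s * t) :
    tOp (r := r) s i * tOp t j * tOp s i = tOp t j * tOp s i * tOp t j := by
  refine LinearMap.ext fun φ => ?_
  funext c
  have h01 : idx0 n i ≠ idx1 n i := idx0_ne_idx1 i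
  have hj : idx0 n j = idx1 n i := by simp [idx0, idx1, hij]
  have h12 : idx1 n i ≠ idx1 n j := hj ▸ idx0_ne_idx1 j
  have h02 : idx0 n i ≠ idx1 n j := by simp [idx0, idx1, Fin.ext_iff]; omega
  let W (a b d : Fin r) : Fin n → Fin r :=
    Function.update (Function.update (Function.update c (idx0 n i) a) (idx1 n i) b) (idx1 n j) d
  have W0 (a b d) : W a b d (idx0 n i) = a := by simp [W, h01, h02]
  have W1 (a b d) : W a b d (idx1 n i) = b := by simp [W, h12]
  have W2 (a b d) : W a b d (idx1 n j) = d := by simp [W]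
  have W3 (a b d k) (h0 : k ≠ idx0 n i) (h1 : k ≠ idx1 n i) (h2 : k ≠ idx1 n j) :
      W a b d k = c k := by simp [W, h0, h1, h2]
  have hWc : W (c (idx0 n i)) (c (idx1 n i)) (c (idx1 n j)) = c := by
    simp [W]
  have hWi (a b d) : swapWord i (W a b d) = W b a d := by
    funext k
    by_cases h0 : k = idx0 n i
    · subst h0; simp [W0, W1]
    by_cases h1 : k = idx1 n i
    · subst h1; simp [W0, W1]
    rw [swapWord_of_ne i _ h0 h1]
    by_cases h2 : k = idx1 n j
    · subst h2; simp [W2]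
    rw [W3 _ _ _ _ h0 h1 h2, W3 _ _ _ _ h0 h1 h2]
  have hWj (a b d) : swapWord j (W a b d) = W a d b := by
    funext k
    by_cases h1 : k = idx1 n i
    · subst h1; rw [← hj, swapWord_idx0, hj, W1, W2]
    by_cases h2 : k = idx1 n j
    · subst h2; rw [swapWord_idx1, hj, W1, W2]
    rw [swapWord_of_ne j _ (hj ▸ h1) h2]
    by_cases h0 : k = idx0 n i
    · subst h0; simp [W0]
    rw [W3 _ _ _ _ h0 h1 h2, W3 _ _ _ _ h0 h1 h2]
  have key := braid_three_letters s t hs ht hst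
    (fun g a b d => s * g b a d + if a < b then g b a d - g a b d else 0)
    (fun g a b d => t * g a d b + if b < d then g a d b - g a b d else 0)
    (fun _ _ _ _ => rfl) (fun _ _ _ _ => rfl) (fun a b d => φ (W a b d))
    (c (idx0 n i)) (c (idx1 n i)) (c (idx1 n j))
  rw [← hWc]
  simp only [Module.End.mul_apply, tOp_apply, hWi, hWj, hj, W0, W1, W2]
  exact key

lemma tOp_comm (s t : A) (i j : Fin (n - 1))
    (hij : (i : ℕ) + 2 ≤ (j : ℕ) ∨ (j : ℕ) + 2 ≤ (i : ℕ)) (hst : s * t = t * s) :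
    tOp (r := r) s i * tOp t j = tOp t j * tOp s i := by
  have h00 : idx0 n i ≠ idx0 n j := by simp [idx0, Fin.ext_iff]; omega
  have h01 : idx0 n i ≠ idx1 n j := by simp [idx0, idx1, Fin.ext_iff]; omega
  have h10 : idx1 n i ≠ idx0 n j := by simp [idx0, idx1, Fin.ext_iff]; omega
  have h11 : idx1 n i ≠ idx1 n j := by simp [idx1, Fin.ext_iff]; omega
  have hst' (x : A) : s * (t * x) = t * (s * x) := by simp only [← mul_assoc, hst]
  refine LinearMap.ext fun φ => ?_
  funext c
  have hc : swapWord i (swapWord j c) = swapWord j (swapWord i c) := by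
    funext k
    by_cases h0 : k = idx0 n i
    · subst h0; simp [swapWord_of_ne, *]
    by_cases h1 : k = idx1 n i
    · subst h1; simp [swapWord_of_ne, *]
    by_cases h2 : k = idx0 n j
    · subst h2; simp [swapWord_of_ne, h00.symm, h10.symm, h01.symm, h11.symm]
    by_cases h3 : k = idx1 n j
    · subst h3; simp [swapWord_of_ne, h00.symm, h10.symm, h01.symm, h11.symm]
    simp [swapWord_of_ne, *]
  simp only [Module.End.mul_apply, tOp_apply, swapWord_of_ne j c h00 h01, swapWord_of_ne j c h10 h11,
    swapWord_of_ne i c h00.symm h10.symm, swapWord_of_ne i c h01.symm h11.symm, hc]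
  split_ifs <;> simp only [mul_add, mul_sub, mul_zero, hst'] <;> abel

variable (n r A) in
/-- Multiplication of `A`-valued functions on color words by scalar functions. -/
def diagOp : ((Fin n → Fin r) → ℂ) →ₐ[ℂ] Module.End ℂ ((Fin n → Fin r) → A) where
  toFun f :=
    { toFun := fun φ c => f c • φ c
      map_add' := fun φ ψ => funext fun c => smul_add (f c) (φ c) (ψ c)
      map_smul' := fun a φ => funext fun c => smul_comm (f c) a (φ c) }
  map_one' := LinearMap.ext fun φ => funext fun c => one_smul ℂ (φ c)
  map_mul' f g := LinearMap.ext fun φ => funext fun c => mul_smul (f c) (g c) (φ c)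
  map_zero' := LinearMap.ext fun φ => funext fun c => zero_smul ℂ (φ c)
  map_add' f g := LinearMap.ext fun φ => funext fun c => add_smul (f c) (g c) (φ c)
  commutes' _ := rfl

@[simp] lemma diagOp_apply (f : (Fin n → Fin r) → ℂ) (φ : (Fin n → Fin r) → A)
    (c : Fin n → Fin r) : diagOp n r A f φ c = f c • φ c := rfl

lemma lagPoly_eq_basis (u : Fin r → ℂ) (k : Fin r) :
    lagPoly r u k = Lagrange.basis Finset.univ u k := rfl

lemma eval_lagPoly (u : Fin r → ℂ) (hu : Function.Injective u) (k a : Fin r) :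
    (lagPoly r u k).eval (u a) = if k = a then 1 else 0 := by
  rw [lagPoly_eq_basis]
  split_ifs with h
  · subst h; exact Lagrange.eval_basis_self hu.injOn (Finset.mem_univ _)
  · exact Lagrange.eval_basis_of_ne h (Finset.mem_univ _)

lemma aeval_diagOp (f : (Fin n → Fin r) → ℂ) (p : ℂ[X]) :
    Polynomial.aeval (diagOp n r A f) p = diagOp n r A (fun c => p.eval (f c)) := by
  rw [Polynomial.aeval_algHom_apply]
  congr 1
  funext c
  simp

end Representation

section Generators

variable {n r : ℕ} {u : Fin r → ℂ}

lemma hT_quad (i : Fin (n - 1)) : hT n i * (hT n i + 1) = 0 := by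
  simpa [hT] using RingQuot.mkAlgHom_rel ℂ (HeckeRel.quad i)

lemma hT_braid (i j : Fin (n - 1)) (h : (j : ℕ) = (i : ℕ) + 1) :
    hT n i * hT n j * hT n i = hT n j * hT n i * hT n j := by
  simpa [hT] using RingQuot.mkAlgHom_rel ℂ (HeckeRel.braid i j h)

lemma hT_comm (i j : Fin (n - 1)) (h : (i : ℕ) + 2 ≤ (j : ℕ) ∨ (j : ℕ) + 2 ≤ (i : ℕ)) :
    hT n i * hT n j = hT n j * hT n i := by
  simpa [hT] using RingQuot.mkAlgHom_rel ℂ (HeckeRel.commTT i j h)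

/-- The universal property of the `0`-Hecke algebra. -/
def heckeLift {B : Type*} [Ring B] [Algebra ℂ B] (f : Fin (n - 1) → B)
    (quad : ∀ i, f i * (f i + 1) = 0)
    (braid : ∀ i j : Fin (n - 1), (j : ℕ) = (i : ℕ) + 1 → f i * f j * f i = f j * f i * f j)
    (comm : ∀ i j : Fin (n - 1), (i : ℕ) + 2 ≤ (j : ℕ) ∨ (j : ℕ) + 2 ≤ (i : ℕ) →
      f i * f j = f j * f i) : Hecke n →ₐ[ℂ] B :=
  RingQuot.liftAlgHom ℂ ⟨FreeAlgebra.lift ℂ f, by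
    rintro _ _ (i | ⟨i, j, h⟩ | ⟨i, j, h⟩)
    · simpa using quad i
    · simpa using braid i j h
    · simpa using comm i j h⟩

@[simp] lemma heckeLift_hT {B : Type*} [Ring B] [Algebra ℂ B] (f : Fin (n - 1) → B)
    (quad braid comm) (i : Fin (n - 1)) : heckeLift f quad braid comm (hT n i) = f i := by
  simp [heckeLift, hT]

lemma adjoin_range_hT : Algebra.adjoin ℂ (Set.range (hT n)) = ⊤ := by
  have : Set.range (hT n) =
      RingQuot.mkAlgHom ℂ (HeckeRel n) '' Set.range (FreeAlgebra.ι ℂ) := by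
    rw [← Set.range_comp]; rfl
  rw [this, Algebra.adjoin_image, FreeAlgebra.adjoin_range_ι, Algebra.map_top,
    AlgHom.range_eq_top]
  exact RingQuot.mkAlgHom_surjective ℂ _

lemma adjoin_range_Ti_union_range_Xi (q : ℂ) :
    Algebra.adjoin ℂ (Set.range (Ti n r u q) ∪ Set.range (Xi n r u q)) = ⊤ := by
  have : Set.range (Ti n r u q) ∪ Set.range (Xi n r u q) =
      RingQuot.mkAlgHom ℂ (Rel n r u q) '' Set.range (FreeAlgebra.ι ℂ) := by
    rw [← Set.range_comp, ← Set.Sum.elim_range]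
    congr 1
    funext x
    cases x <;> rfl
  rw [this, Algebra.adjoin_image, FreeAlgebra.adjoin_range_ι, Algebra.map_top,
    AlgHom.range_eq_top]
  exact RingQuot.mkAlgHom_surjective ℂ _

lemma Ti_quad (i : Fin (n - 1)) : Ti n r u 0 i * (Ti n r u 0 i + 1) = 0 := by
  simpa [Ti] using RingQuot.mkAlgHom_rel ℂ (Rel.quad (r := r) (u := u) (q := 0) i)

lemma Ti_braid (q : ℂ) (i j : Fin (n - 1)) (h : (j : ℕ) = (i : ℕ) + 1) :
    Ti n r u q i * Ti n r u q j * Ti n r u q i = Ti n r u q j * Ti n r u q i * Ti n r u q j := by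
  simpa [Ti] using RingQuot.mkAlgHom_rel ℂ (Rel.braid (r := r) (u := u) (q := q) i j h)

lemma Ti_comm (q : ℂ) (i j : Fin (n - 1))
    (h : (i : ℕ) + 2 ≤ (j : ℕ) ∨ (j : ℕ) + 2 ≤ (i : ℕ)) :
    Ti n r u q i * Ti n r u q j = Ti n r u q j * Ti n r u q i := by
  simpa [Ti] using RingQuot.mkAlgHom_rel ℂ (Rel.commTT (r := r) (u := u) (q := q) i j h)

lemma Xi_comm (q : ℂ) (i j : Fin n) :
    Xi n r u q i * Xi n r u q j = Xi n r u q j * Xi n r u q i := by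
  simpa [Xi] using RingQuot.mkAlgHom_rel ℂ (Rel.commXX (r := r) (u := u) (q := q) i j)

lemma aeval_Xi (q : ℂ) (j : Fin n) (p : ℂ[X]) :
    Polynomial.aeval (Xi n r u q j) p =
      RingQuot.mkAlgHom ℂ (Rel n r u q) (Polynomial.aeval (xGen n j) p) :=
  Polynomial.aeval_algHom_apply _ _ _

lemma aeval_Xi_prod (q : ℂ) (j : Fin n) :
    Polynomial.aeval (Xi n r u q j) (∏ l : Fin r, (X - C (u l))) = 0 := by
  rw [aeval_Xi, RingQuot.mkAlgHom_rel ℂ (Rel.xPoly j), map_zero]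

/-- The inclusion of the `0`-Hecke algebra into the `0`-Ariki-Koike-Shoji algebra. -/
def heckeToAKS (n r : ℕ) (u : Fin r → ℂ) : Hecke n →ₐ[ℂ] AKSAlg n r u 0 :=
  heckeLift (Ti n r u 0) Ti_quad (Ti_braid 0) (Ti_comm 0)

@[simp] lemma heckeToAKS_hT (i : Fin (n - 1)) : heckeToAKS n r u (hT n i) = Ti n r u 0 i :=
  heckeLift_hT ..

lemma range_heckeToAKS :
    (heckeToAKS n r u).range = Algebra.adjoin ℂ (Set.range (Ti n r u 0)) := by
  rw [← Algebra.map_top, ← adjoin_range_hT, ← Algebra.adjoin_image, ← Set.range_comp]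
  congr 2
  funext i
  simp

/-- The operator by which `ξ_j` acts on functions on color words with values in `H_n(0)`. -/
def xOp (u : Fin r → ℂ) (j : Fin n) : Module.End ℂ ((Fin n → Fin r) → Hecke n) :=
  diagOp n r (Hecke n) (fun c => u (c j))

lemma lift_aeval_xGen (j : Fin n) (p : ℂ[X]) :
    FreeAlgebra.lift ℂ (Sum.elim (fun i => tOp (r := r) (hT n i) i) (xOp u))
      (Polynomial.aeval (xGen n j) p) = diagOp n r (Hecke n) (fun c => p.eval (u (c j))) := by
  rw [← Polynomial.aeval_algHom_apply, xGen, FreeAlgebra.lift_ι_apply, Sum.elim_inr, xOp,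
    aeval_diagOp]

/-- The action of `H_{n,r}(0)` on the functions on color words with values in `H_n(0)`. -/
def aksRep (n r : ℕ) (u : Fin r → ℂ) (hu : Function.Injective u) :
    AKSAlg n r u 0 →ₐ[ℂ] Module.End ℂ ((Fin n → Fin r) → Hecke n) :=
  RingQuot.liftAlgHom ℂ ⟨FreeAlgebra.lift ℂ
      (Sum.elim (fun i => tOp (hT n i) i) (xOp u)), by
    rintro _ _ (i | ⟨i, j, h⟩ | ⟨i, j, h⟩ | j | ⟨i, j⟩ | i | i | ⟨i, j, h, h'⟩)
    · simpa [tGen, -mul_eq_zero] using tOp_quad _ i (hT_quad i)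
    · simpa [tGen] using tOp_braid _ _ i j h (hT_quad i) (hT_quad j) (hT_braid i j h)
    · simpa [tGen] using tOp_comm _ _ i j h (hT_comm i j h)
    · rw [lift_aeval_xGen, map_zero, ← map_zero (diagOp n r (Hecke n))]
      congr 1
      funext c
      rw [Polynomial.eval_prod]
      exact Finset.prod_eq_zero (Finset.mem_univ (c j)) (by simp)
    · simp only [map_mul, xGen, FreeAlgebra.lift_ι_apply, Sum.elim_inr, xOp]
      rw [← map_mul, mul_comm, map_mul]
    · simp only [map_mul, map_sub, map_sum, map_smul, lift_aeval_xGen]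
      simp only [eval_lagPoly u hu, tGen, xGen, FreeAlgebra.lift_ι_apply, Sum.elim_inr,
        Sum.elim_inl, xOp, ← map_mul, ← map_smul, ← map_sum]
      refine LinearMap.ext fun φ => ?_
      funext c
      have hsum : (∑ p ∈ Finset.univ.filter (fun p : Fin r × Fin r => p.1 < p.2),
          (u p.2 - u p.1) • ((fun c : Fin n → Fin r => if p.1 = c (idx0 n i) then (1 : ℂ) else 0) *
            fun c : Fin n → Fin r => if p.2 = c (idx1 n i) then (1 : ℂ) else 0)) c =
          if c (idx0 n i) < c (idx1 n i) then u (c (idx1 n i)) - u (c (idx0 n i)) else 0 := by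
        simp only [Finset.sum_apply, Pi.smul_apply, Pi.mul_apply, smul_eq_mul]
        rw [Finset.sum_filter, Finset.sum_eq_single (c (idx0 n i), c (idx1 n i))]
        · simp
        · rintro ⟨a, b⟩ - hab
          by_cases ha : a = c (idx0 n i)
          · have hb : b ≠ c (idx1 n i) := fun hb => hab (by rw [ha, hb])
            simp [hb]
          · simp [ha]
        · simp
      simp only [LinearMap.sub_apply, Module.End.mul_apply, diagOp_apply, tOp_apply,
        Pi.smul_apply, hsum, swapWord_idx0, Pi.sub_apply]
      split_ifs
      · simp only [smul_add, smul_sub, mul_smul_comm, smul_eq_mul, sub_mul]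
        simp
        module
      · simp
    · refine LinearMap.ext fun φ => ?_
      funext c
      simp only [map_mul, map_add, tGen, xGen, FreeAlgebra.lift_ι_apply, Sum.elim_inr,
        Sum.elim_inl, xOp, LinearMap.add_apply, Module.End.mul_apply, diagOp_apply, tOp_apply,
        Pi.add_apply, swapWord_idx0, swapWord_idx1]
      split_ifs <;> simp only [smul_add, smul_sub, mul_smul_comm, mul_add, smul_zero] <;> abel
    · refine LinearMap.ext fun φ => ?_
      funext c
      simp only [map_mul, tGen, xGen, FreeAlgebra.lift_ι_apply, Sum.elim_inr,
        Sum.elim_inl, xOp, Module.End.mul_apply, diagOp_apply, tOp_apply, swapWord_of_ne i c h h']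
      split_ifs <;> simp [smul_sub, smul_add]⟩

@[simp] lemma aksRep_Ti (hu : Function.Injective u) (i : Fin (n - 1)) :
    aksRep n r u hu (Ti n r u 0 i) = tOp (hT n i) i := by
  simp [aksRep, Ti, tGen]

@[simp] lemma aksRep_Xi (hu : Function.Injective u) (j : Fin n) :
    aksRep n r u hu (Xi n r u 0 j) = diagOp n r (Hecke n) (fun c => u (c j)) := by
  simp [aksRep, Xi, xGen, xOp]

lemma aksRep_heckeToAKS_const (hu : Function.Injective u) (h x : Hecke n) :
    aksRep n r u hu (heckeToAKS n r u h) (fun _ => x) = fun _ => h * x := by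
  have hh : h ∈ Algebra.adjoin ℂ (Set.range (hT n)) := adjoin_range_hT ▸ Algebra.mem_top
  induction hh using Algebra.adjoin_induction generalizing x with
  | mem _ hx => obtain ⟨i, rfl⟩ := hx; simp [tOp_const]
  | algebraMap a =>
    funext c
    simp [Algebra.algebraMap_eq_smul_one]
  | add a b _ _ ha hb => funext c; simp [ha, hb, add_mul]
  | mul a b _ _ ha hb => funext c; simp [ha, hb, mul_assoc]

lemma aksRep_Lc (hu : Function.Injective u) (c : Fin n → Fin r) :
    aksRep n r u hu (Lc n r u 0 c) = diagOp n r (Hecke n) (Pi.single c 1) := by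
  rw [Lc, map_list_prod, List.map_ofFn]
  have : (⇑(aksRep n r u hu) ∘ fun j => Polynomial.aeval (Xi n r u 0 j) (lagPoly r u (c j))) =
      ⇑(diagOp n r (Hecke n)) ∘ fun (j : Fin n) (d : Fin n → Fin r) =>
        if c j = d j then (1 : ℂ) else 0 := by
    funext j
    simp only [Function.comp_apply]
    rw [← Polynomial.aeval_algHom_apply, aksRep_Xi, aeval_diagOp]
    simp only [eval_lagPoly u hu]
  rw [this, ← List.map_ofFn, ← map_list_prod, List.prod_ofFn]
  congr 1
  funext d
  rw [Finset.prod_apply, Pi.single_apply]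
  split_ifs with h
  · subst h; simp
  · obtain ⟨j, hj⟩ := Function.ne_iff.1 h
    exact Finset.prod_eq_zero (Finset.mem_univ j) (if_neg (Ne.symm hj))

lemma aksRep_sum_Lc_mul (hu : Function.Injective u) (b : (Fin n → Fin r) → Hecke n) :
    aksRep n r u hu (∑ c, Lc n r u 0 c * heckeToAKS n r u (b c)) (fun _ => 1) = b := by
  funext d
  simp [aksRep_Lc, aksRep_heckeToAKS_const, Pi.single_apply]

lemma heckeToAKS_injective (hu : Function.Injective u) (hr : 1 ≤ r) :
    Function.Injective (heckeToAKS n r u) := by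
  intro h h' hh
  have := congrArg (fun a => aksRep n r u hu a (fun _ => 1) (fun _ => ⟨0, hr⟩)) hh
  simpa [aksRep_heckeToAKS_const] using this

end Generators

section Spanning

variable {n r : ℕ} {u : Fin r → ℂ}

lemma mul_prod_ofFn_eq_smul {B : Type*} [Ring B] [Algebra ℂ B] {m : ℕ} (g : Fin m → B) (x : B)
    (a : ℂ) (hx : ∀ j, x * g j = g j * x) (j : Fin m) (hj : x * g j = a • g j) :
    x * (List.ofFn g).prod = a • (List.ofFn g).prod := by
  induction m with
  | zero => exact j.elim0
  | succ m ih =>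
    rw [List.ofFn_succ, List.prod_cons]
    refine Fin.cases (fun h => ?_) (fun j h => ?_) j hj
    · rw [← mul_assoc, h, smul_mul_assoc]
    · rw [← mul_assoc, hx, mul_assoc, ih (fun i => g i.succ) (fun i => hx i.succ) j h,
        mul_smul_comm]

lemma sum_prod_ofFn_eq_one {B K : Type*} [Ring B] [Fintype K] {m : ℕ} (g : Fin m → K → B)
    (hg : ∀ j, ∑ k, g j k = 1) :
    ∑ c : Fin m → K, (List.ofFn fun j => g j (c j)).prod = 1 := by
  induction m with
  | zero => simp
  | succ m ih =>
    rw [← (Fin.consEquiv fun _ => K).sum_comp, Fintype.sum_prod_type]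
    simp only [Fin.consEquiv_apply, List.ofFn_succ, Fin.cons_zero, Fin.cons_succ, List.prod_cons]
    simp only [← Finset.mul_sum, ih (fun j => g j.succ) (fun j => hg j.succ), mul_one, hg]

lemma X_mul_lagPoly (k : Fin r) :
    (X - C (u k)) * lagPoly r u k =
      C (∏ l ∈ Finset.univ.erase k, (u k - u l)⁻¹) * ∏ l : Fin r, (X - C (u l)) := by
  rw [lagPoly, Finset.prod_mul_distrib, ← map_prod,
    ← Finset.mul_prod_erase Finset.univ (fun l => X - C (u l)) (Finset.mem_univ k)]
  ring

lemma Xi_mul_aeval_lagPoly (j : Fin n) (k : Fin r) :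
    Xi n r u 0 j * Polynomial.aeval (Xi n r u 0 j) (lagPoly r u k) =
      u k • Polynomial.aeval (Xi n r u 0 j) (lagPoly r u k) := by
  have := congrArg (Polynomial.aeval (Xi n r u 0 j)) (X_mul_lagPoly (u := u) k)
  rw [map_mul, map_mul, aeval_Xi_prod, mul_zero, map_sub, aeval_X, aeval_C, sub_mul,
    sub_eq_zero] at this
  rw [this, Algebra.smul_def]

lemma Xi_mul_Lc (j : Fin n) (c : Fin n → Fin r) :
    Xi n r u 0 j * Lc n r u 0 c = u (c j) • Lc n r u 0 c := by
  refine mul_prod_ofFn_eq_smul _ _ _ (fun i => ?_) j (Xi_mul_aeval_lagPoly j (c j))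
  have : Commute (Xi n r u 0 j) (Xi n r u 0 i) := Xi_comm 0 j i
  exact Algebra.commute_of_mem_adjoin_of_forall_mem_commute
    (s := {Xi n r u 0 i}) (aeval_mem_adjoin_singleton ℂ _)
    (fun b hb => by rw [Set.mem_singleton_iff.1 hb]; exact this)

lemma sum_Lc (hr : 1 ≤ r) (hu : Function.Injective u) :
    ∑ c : Fin n → Fin r, Lc n r u 0 c = 1 := by
  refine sum_prod_ofFn_eq_one
    (fun (j : Fin n) (k : Fin r) => Polynomial.aeval (Xi n r u 0 j) (lagPoly r u k)) fun j => ?_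
  have : Nonempty (Fin r) := ⟨⟨0, hr⟩⟩
  rw [← map_sum]
  simp only [lagPoly_eq_basis]
  rw [Lagrange.sum_basis hu.injOn Finset.univ_nonempty, map_one]

lemma adjoin_Xi_le_span_Lc (hr : 1 ≤ r) (hu : Function.Injective u) :
    Subalgebra.toSubmodule (Algebra.adjoin ℂ (Set.range (Xi n r u 0))) ≤
      Submodule.span ℂ (Set.range (Lc n r u 0)) := by
  intro f hf
  rw [Subalgebra.mem_toSubmodule] at hf
  have key : ∀ y ∈ Submodule.span ℂ (Set.range (Lc n r u 0)),
      f * y ∈ Submodule.span ℂ (Set.range (Lc n r u 0)) := by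
    induction hf using Algebra.adjoin_induction with
    | mem _ hx =>
      obtain ⟨j, rfl⟩ := hx
      intro y hy
      induction hy using Submodule.span_induction with
      | mem _ hy =>
        obtain ⟨c, rfl⟩ := hy
        rw [Xi_mul_Lc]
        exact Submodule.smul_mem _ _ (Submodule.subset_span ⟨c, rfl⟩)
      | zero => simp
      | add a b _ _ ha hb => rw [mul_add]; exact add_mem ha hb
      | smul a b _ hb => rw [mul_smul_comm]; exact Submodule.smul_mem _ _ hb
    | algebraMap a => intro y hy; rw [← Algebra.smul_def]; exact Submodule.smul_mem _ _ hy
    | add a b _ _ ha hb => intro y hy; rw [add_mul]; exact add_mem (ha y hy) (hb y hy)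
    | mul a b _ _ ha hb => intro y hy; rw [mul_assoc]; exact ha _ (hb y hy)
  have h1 : (1 : AKSAlg n r u 0) ∈ Submodule.span ℂ (Set.range (Lc n r u 0)) := by
    rw [← sum_Lc hr hu]
    exact Submodule.sum_mem _ fun c _ => Submodule.subset_span ⟨c, rfl⟩
  simpa using key 1 h1

lemma Ti_mul_Xi (i : Fin (n - 1)) (j : Fin n) :
    ∃ a ∈ Algebra.adjoin ℂ (Set.range (Xi n r u 0)),
      ∃ b ∈ Algebra.adjoin ℂ (Set.range (Xi n r u 0)),
        Ti n r u 0 i * Xi n r u 0 j = a * Ti n r u 0 i + b := by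
  have hX (k : Fin n) : Xi n r u 0 k ∈ Algebra.adjoin ℂ (Set.range (Xi n r u 0)) :=
    Algebra.subset_adjoin ⟨k, rfl⟩
  have hP (k : Fin n) (p : ℂ[X]) :
      Polynomial.aeval (Xi n r u 0 k) p ∈ Algebra.adjoin ℂ (Set.range (Xi n r u 0)) :=
    Algebra.adjoin_mono (Set.singleton_subset_iff.2 (Set.mem_range_self k)) (aeval_mem_adjoin_singleton ℂ _)
  obtain ⟨b, hb, h⟩ : ∃ b ∈ Algebra.adjoin ℂ (Set.range (Xi n r u 0)),
      Ti n r u 0 i * Xi n r u 0 (idx0 n i) = Xi n r u 0 (idx1 n i) * Ti n r u 0 i - b := by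
    have := RingQuot.mkAlgHom_rel ℂ (Rel.cross (r := r) (u := u) (q := 0) i)
    simp only [map_mul, map_sub, map_smul, map_sum, ← aeval_Xi] at this
    exact ⟨_, Subalgebra.smul_mem _ (sum_mem fun p _ =>
      Subalgebra.smul_mem _ (mul_mem (hP _ _) (hP _ _)) _) _, this⟩
  by_cases h0 : j = idx0 n i
  · subst h0
    exact ⟨_, hX _, _, neg_mem hb, by rw [h, sub_eq_add_neg]⟩
  by_cases h1 : j = idx1 n i
  · subst h1
    have hs := RingQuot.mkAlgHom_rel ℂ (Rel.sumComm (r := r) (u := u) (q := 0) i)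
    simp only [map_mul, map_add] at hs
    change Ti n r u 0 i * (Xi n r u 0 (idx1 n i) + Xi n r u 0 (idx0 n i)) =
      (Xi n r u 0 (idx1 n i) + Xi n r u 0 (idx0 n i)) * Ti n r u 0 i at hs
    rw [mul_add, h, add_mul] at hs
    refine ⟨_, hX (idx0 n i), b, hb, ?_⟩
    rw [eq_sub_of_add_eq hs]
    abel
  · have := RingQuot.mkAlgHom_rel ℂ (Rel.commTX (r := r) (u := u) (q := 0) i j h0 h1)
    simp only [map_mul] at this
    exact ⟨_, hX j, 0, zero_mem _, by rw [add_zero]; exact this⟩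

lemma Ti_mul_mem_adjoin_Xi (i : Fin (n - 1)) {f : AKSAlg n r u 0}
    (hf : f ∈ Algebra.adjoin ℂ (Set.range (Xi n r u 0))) :
    ∃ a ∈ Algebra.adjoin ℂ (Set.range (Xi n r u 0)),
      ∃ b ∈ Algebra.adjoin ℂ (Set.range (Xi n r u 0)),
        Ti n r u 0 i * f = a * Ti n r u 0 i + b := by
  induction hf using Algebra.adjoin_induction with
  | mem _ hx => obtain ⟨j, rfl⟩ := hx; exact Ti_mul_Xi i j
  | algebraMap x =>
    exact ⟨algebraMap ℂ _ x, Subalgebra.algebraMap_mem _ x, 0, zero_mem _, by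
      rw [add_zero, Algebra.commutes]⟩
  | add x y _ _ hx hy =>
    obtain ⟨a, ha, b, hb, h⟩ := hx
    obtain ⟨a', ha', b', hb', h'⟩ := hy
    exact ⟨_, add_mem ha ha', _, add_mem hb hb', by rw [mul_add, h, h', add_mul]; abel⟩
  | mul x y _ hy hx' hy' =>
    obtain ⟨a, ha, b, hb, h⟩ := hx'
    obtain ⟨a', ha', b', hb', h'⟩ := hy'
    refine ⟨_, mul_mem ha ha', _, add_mem (mul_mem ha hb') (mul_mem hb hy), ?_⟩
    rw [← mul_assoc, h, add_mul, mul_assoc, h', mul_add, mul_assoc, add_assoc]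

lemma adjoin_Xi_mul_adjoin_Ti :
    Subalgebra.toSubmodule (Algebra.adjoin ℂ (Set.range (Xi n r u 0))) *
      Subalgebra.toSubmodule (Algebra.adjoin ℂ (Set.range (Ti n r u 0))) = ⊤ := by
  set M := Subalgebra.toSubmodule (Algebra.adjoin ℂ (Set.range (Xi n r u 0))) *
      Subalgebra.toSubmodule (Algebra.adjoin ℂ (Set.range (Ti n r u 0))) with hM
  have hmem {f h : AKSAlg n r u 0} (hf : f ∈ Algebra.adjoin ℂ (Set.range (Xi n r u 0)))
      (hh : h ∈ Algebra.adjoin ℂ (Set.range (Ti n r u 0))) : f * h ∈ M :=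
    Submodule.mul_mem_mul hf hh
  have key (a : AKSAlg n r u 0) : ∀ y ∈ M, a * y ∈ M := by
    have ha : a ∈ Algebra.adjoin ℂ (Set.range (Ti n r u 0) ∪ Set.range (Xi n r u 0)) :=
      adjoin_range_Ti_union_range_Xi 0 ▸ Algebra.mem_top
    induction ha using Algebra.adjoin_induction with
    | mem _ hx =>
      intro y hy
      induction hy using Submodule.mul_induction_on' with
      | mem_mul_mem f hf h hh =>
        rw [Subalgebra.mem_toSubmodule] at hf hh
        rcases hx with ⟨i, rfl⟩ | ⟨j, rfl⟩
        · obtain ⟨a, ha, b, hb, hab⟩ := Ti_mul_mem_adjoin_Xi i hf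
          rw [← mul_assoc, hab, add_mul, mul_assoc]
          exact add_mem (hmem ha (mul_mem (Algebra.subset_adjoin ⟨i, rfl⟩) hh)) (hmem hb hh)
        · rw [← mul_assoc]
          exact hmem (mul_mem (Algebra.subset_adjoin ⟨j, rfl⟩) hf) hh
      | add a _ b _ ha hb => rw [mul_add]; exact add_mem ha hb
    | algebraMap a => intro y hy; rw [← Algebra.smul_def]; exact Submodule.smul_mem _ _ hy
    | add a b _ _ ha hb => intro y hy; rw [add_mul]; exact add_mem (ha y hy) (hb y hy)
    | mul a b _ _ ha hb => intro y hy; rw [mul_assoc]; exact ha _ (hb y hy)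
  rw [eq_top_iff]
  intro a _
  simpa using key a 1 (by simpa using hmem (one_mem _) (one_mem _))

lemma exists_eq_sum_Lc_mul (hr : 1 ≤ r) (hu : Function.Injective u) (a : AKSAlg n r u 0) :
    ∃ b : (Fin n → Fin r) → Hecke n, a = ∑ c, Lc n r u 0 c * heckeToAKS n r u (b c) := by
  let Λ : ((Fin n → Fin r) → Hecke n) →ₗ[ℂ] AKSAlg n r u 0 :=
    ∑ c, LinearMap.mulLeft ℂ (Lc n r u 0 c) ∘ₗ (heckeToAKS n r u).toLinearMap ∘ₗ LinearMap.proj c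
  have hΛ (b) : Λ b = ∑ c, Lc n r u 0 c * heckeToAKS n r u (b c) := by simp [Λ]
  suffices a ∈ LinearMap.range Λ by
    obtain ⟨b, hb⟩ := this
    exact ⟨b, by rw [← hΛ, hb]⟩
  have ha : a ∈ Subalgebra.toSubmodule (Algebra.adjoin ℂ (Set.range (Xi n r u 0))) *
      Subalgebra.toSubmodule (Algebra.adjoin ℂ (Set.range (Ti n r u 0))) :=
    adjoin_Xi_mul_adjoin_Ti ▸ Submodule.mem_top
  refine Submodule.mul_le.2 (fun f hf h hh => ?_) ha
  rw [Subalgebra.mem_toSubmodule, ← range_heckeToAKS] at hh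
  obtain ⟨h, rfl⟩ := hh
  suffices Submodule.span ℂ (Set.range (Lc n r u 0)) ≤
      (LinearMap.range Λ).comap (LinearMap.mulRight ℂ (heckeToAKS n r u h)) from
    this (adjoin_Xi_le_span_Lc hr hu hf)
  rw [Submodule.span_le]
  rintro _ ⟨c, rfl⟩
  refine ⟨Pi.single c h, ?_⟩
  rw [hΛ, Finset.sum_eq_single c]
  · simp
  · intro d _ hd; simp [hd]
  · simp

end Spanning

section Dimension

/-- The descending product `T_m T_{m-1} ⋯ T_{m-k+1}`. -/
def descProd {B : Type*} [Ring B] (T : ℕ → B) (m : ℕ) : ℕ → B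
  | 0 => 1
  | k + 1 => descProd T m k * T (m - k)

variable {n : ℕ} {B : Type*} [Ring B] {T : ℕ → B}

lemma descProd_mul_comm (comm : ∀ i j, i + 2 ≤ j → T i * T j = T j * T i) {m j : ℕ} (k : ℕ)
    (h : j + k < m) : descProd T m k * T j = T j * descProd T m k := by
  induction k with
  | zero => simp [descProd]
  | succ k ih =>
    rw [descProd, mul_assoc, ← comm j (m - k) (by omega), ← mul_assoc, ih (by omega), mul_assoc]

lemma descProd_mul_eq_neg (quad : ∀ i, T i * (T i + 1) = 0) (m k : ℕ) :
    descProd T m (k + 1) * T (m - k) = -descProd T m (k + 1) := by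
  have := quad (m - k)
  rw [mul_add_one, ← eq_neg_iff_add_eq_zero] at this
  rw [descProd, mul_assoc, this, mul_neg]

lemma descProd_mul_shift (comm : ∀ i j, i + 2 ≤ j → T i * T j = T j * T i)
    (braid : ∀ i, T i * T (i + 1) * T i = T (i + 1) * T i * T (i + 1)) {m j k : ℕ}
    (h : m ≤ j + k + 1) (hk : k + 1 ≤ m) (hj : j + 1 ≤ m) :
    descProd T m (k + 2) * T (j + 1) = T j * descProd T m (k + 2) := by
  have base {k : ℕ} (h : m = j + k + 1) :
      descProd T m (k + 2) * T (j + 1) = T j * descProd T m (k + 2) := by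
    have h1 : m - k = j + 1 := by omega
    have h2 : m - (k + 1) = j := by omega
    rw [descProd, descProd, h1, h2, mul_assoc, mul_assoc, ← mul_assoc (T (j + 1)), ← braid,
      ← mul_assoc, ← mul_assoc, descProd_mul_comm comm k (by omega)]
    simp only [mul_assoc]
  induction k with
  | zero => exact base (by omega)
  | succ k ih =>
    rcases eq_or_lt_of_le h with h | h
    · exact base h
    · rw [descProd, mul_assoc, comm (m - (k + 2)) (j + 1) (by omega), ← mul_assoc,
        ih (by omega) (by omega), mul_assoc]

open Pointwise in
lemma exists_finset_adjoin_le_span [Algebra ℂ B] (quad : ∀ i, T i * (T i + 1) = 0)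
    (comm : ∀ i j, i + 2 ≤ j → T i * T j = T j * T i)
    (braid : ∀ i, T i * T (i + 1) * T i = T (i + 1) * T i * T (i + 1)) (m : ℕ) :
    ∃ S : Finset B, S.card ≤ (m + 1).factorial ∧
      Subalgebra.toSubmodule (Algebra.adjoin ℂ (T '' Set.Iio m)) ≤ Submodule.span ℂ S := by
  classical
  induction m with
  | zero =>
    refine ⟨{1}, by simp, ?_⟩
    simp [Algebra.toSubmodule_bot, Submodule.one_eq_span]
  | succ m ih =>
    obtain ⟨S, hS, hSV⟩ := ih
    refine ⟨S * (Finset.range (m + 2)).image (descProd T m), ?_, ?_⟩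
    · calc _ ≤ S.card * ((Finset.range (m + 2)).image (descProd T m)).card := Finset.card_mul_le
        _ ≤ (m + 1).factorial * (m + 2) :=
          Nat.mul_le_mul hS (Finset.card_image_le.trans (Finset.card_range _).le)
        _ = (m + 2).factorial := by rw [Nat.factorial_succ (m + 1), mul_comm]
    set V := Algebra.adjoin ℂ (T '' Set.Iio m) with hV
    set W := Submodule.span ℂ (((Finset.range (m + 2)).image (descProd T m) : Finset B) : Set B)
      with hW
    have hTV {j : ℕ} (hj : j < m) : T j ∈ V := Algebra.subset_adjoin ⟨j, hj, rfl⟩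
    have hmem {v : B} {k : ℕ} (hv : v ∈ V) (hk : k < m + 2) :
        v * descProd T m k ∈ Subalgebra.toSubmodule V * W :=
      Submodule.mul_mem_mul hv (Submodule.subset_span (by simpa using ⟨k, hk, rfl⟩))
    have hgen {v : B} {j k : ℕ} (hv : v ∈ V) (hj : j < m + 1) (hk : k < m + 2) :
        v * descProd T m k * T j ∈ Subalgebra.toSubmodule V * W := by
      rw [mul_assoc]
      rcases lt_trichotomy (j + k) m with h | h | h
      · rw [descProd_mul_comm comm k h, ← mul_assoc]
        exact hmem (mul_mem hv (hTV (by omega))) hk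
      · have : descProd T m k * T j = descProd T m (k + 1) := by
          rw [descProd, show m - k = j by omega]
        rw [this]
        exact hmem hv (by omega)
      · obtain _ | k := k
        · omega
        rcases eq_or_ne (j + k) m with h' | h'
        · rw [show j = m - k by omega, descProd_mul_eq_neg quad, mul_neg]
          exact neg_mem (hmem hv hk)
        · obtain _ | k := k
          · omega
          obtain _ | j := j
          · omega
          rw [descProd_mul_shift comm braid (by omega) (by omega) (by omega), ← mul_assoc]
          exact hmem (mul_mem hv (hTV (by omega))) hk
    have key {a : B} (ha : a ∈ Algebra.adjoin ℂ (T '' Set.Iio (m + 1))) :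
        ∀ y ∈ Subalgebra.toSubmodule V * W, y * a ∈ Subalgebra.toSubmodule V * W := by
      induction ha using Algebra.adjoin_induction with
      | mem _ hx =>
        obtain ⟨j, hj, rfl⟩ := hx
        suffices Subalgebra.toSubmodule V * W ≤
            (Subalgebra.toSubmodule V * W).comap (LinearMap.mulRight ℂ (T j)) from
          fun y hy => this hy
        rw [Submodule.mul_le]
        intro v hv w hw
        suffices W ≤ (Subalgebra.toSubmodule V * W).comap
            (LinearMap.mulRight ℂ (T j) ∘ₗ LinearMap.mulLeft ℂ v) from this hw
        rw [hW, Submodule.span_le]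
        intro w hw
        obtain ⟨k, hk, rfl⟩ := Finset.mem_image.1 (Finset.mem_coe.1 hw)
        exact hgen hv hj (Finset.mem_range.1 hk)
      | algebraMap a =>
        intro y hy
        rw [← Algebra.commutes, ← Algebra.smul_def]
        exact Submodule.smul_mem _ _ hy
      | add a b _ _ ha hb => intro y hy; rw [mul_add]; exact add_mem (ha y hy) (hb y hy)
      | mul a b _ _ ha hb => intro y hy; rw [← mul_assoc]; exact hb _ (ha y hy)
    rw [Finset.coe_mul, ← Submodule.span_mul_span]
    refine le_trans (fun a ha => ?_) (mul_le_mul' hSV le_rfl)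
    have h1 : (1 : B) ∈ Subalgebra.toSubmodule V * W := by
      simpa [descProd] using hmem (one_mem V) (Nat.succ_pos (m + 1))
    exact one_mul a ▸ key ha 1 h1

lemma exists_finset_span_hecke (n : ℕ) :
    ∃ S : Finset (Hecke n), S.card ≤ (n - 1 + 1).factorial ∧
      Submodule.span ℂ (S : Set (Hecke n)) = ⊤ := by
  let T (k : ℕ) : Hecke n := if h : k < n - 1 then hT n ⟨k, h⟩ else 0
  obtain ⟨S, hS, hle⟩ := exists_finset_adjoin_le_span (T := T)
    (fun i => by
      dsimp only [T]
      split_ifs with h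
      · exact hT_quad _
      · rw [zero_mul])
    (fun i j hij => by
      dsimp only [T]
      split_ifs
      · exact hT_comm _ _ (Or.inl hij)
      all_goals simp only [mul_zero, zero_mul])
    (fun i => by
      dsimp only [T]
      split_ifs
      · exact hT_braid _ _ rfl
      all_goals simp only [mul_zero, zero_mul])
    (n - 1)
  refine ⟨S, hS, eq_top_iff.2 (le_trans ?_ hle)⟩
  rw [← Algebra.top_toSubmodule, ← adjoin_range_hT]
  refine Subalgebra.toSubmodule.monotone (Algebra.adjoin_mono ?_)
  rintro _ ⟨i, rfl⟩
  exact ⟨i, i.2, by simp [T]⟩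

/-- The action of `H_n(0)` on complex-valued functions on words in which every `T_i` kills the
constant functions. -/
def wordRep (n : ℕ) : Hecke n →ₐ[ℂ] Module.End ℂ ((Fin n → Fin n) → ℂ) :=
  heckeLift (fun i => tOp 0 i) (fun i => tOp_quad 0 i (zero_mul _))
    (fun i j h => tOp_braid 0 0 i j h (zero_mul _) (zero_mul _) rfl)
    (fun i j h => tOp_comm 0 0 i j h rfl)

lemma wordRep_hT_add_one (i : Fin (n - 1)) (φ : (Fin n → Fin n) → ℂ) (c : Fin n → Fin n)
    (h : c (idx0 n i) < c (idx1 n i)) : wordRep n (hT n i + 1) φ c = φ (swapWord i c) := by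
  simp [wordRep, tOp_apply, h]

lemma exists_wordRep_apply_eq (n : ℕ) (w : Equiv.Perm (Fin n)) :
    ∃ h : Hecke n, ∀ φ : (Fin n → Fin n) → ℂ, wordRep n h φ id = φ w := by
  obtain ⟨c, hc⟩ : ∃ c, toLex (w : Fin n → Fin n) = c := ⟨_, rfl⟩
  induction c using WellFoundedLT.induction generalizing w with
  | ind c ih =>
    subst hc
    by_cases hw : ∃ i : Fin (n - 1), w (idx1 n i) < w (idx0 n i)
    · obtain ⟨i, hi⟩ := hw
      have hle : idx0 n i ≤ idx1 n i := by simp [idx0, idx1, Fin.le_def]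
      obtain ⟨h, hh⟩ := ih _ (Pi.lex_desc hle hi) (w * Equiv.swap (idx0 n i) (idx1 n i)) rfl
      refine ⟨h * (hT n i + 1), fun φ => ?_⟩
      rw [map_mul, Module.End.mul_apply, hh, wordRep_hT_add_one]
      · congr 1
        exact swapWord_swapWord i w
      · simpa using hi
    · push Not at hw
      have : (w : Fin n → Fin n) = id := by
        obtain _ | m := n
        · exact Subsingleton.elim _ _
        have hmono : StrictMono w := Fin.strictMono_iff_lt_succ.2 fun i =>
          (hw i).lt_of_ne fun h => (Fin.castSucc_lt_succ (i := i)).ne (w.injective h)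
        exact (hmono.range_inj strictMono_id).1 (by rw [w.range_eq_univ, Set.range_id])
      exact ⟨1, fun φ => by rw [map_one, this]; rfl⟩

lemma finrank_hecke (n : ℕ) (hn : 1 ≤ n) : Module.finrank ℂ (Hecke n) = n.factorial := by
  obtain ⟨S, hS, hspan⟩ := exists_finset_span_hecke n
  have : Module.Finite ℂ (Hecke n) := ⟨⟨S, hspan⟩⟩
  apply le_antisymm
  · rw [Nat.sub_add_cancel hn] at hS
    rw [← finrank_top, ← hspan]
    exact (finrank_span_finset_le_card S).trans hS
  · choose h hh using exists_wordRep_apply_eq n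
    have hli : LinearIndependent ℂ h := by
      rw [Fintype.linearIndependent_iff]
      intro a ha w
      have := congrArg (fun x => wordRep n x (Pi.single w 1) id) ha
      simpa [hh, Pi.single_apply, DFunLike.coe_fn_eq] using this
    simpa [Fintype.card_perm] using hli.fintype_card_le_finrank

end Dimension

/-- the subalgebra of `H_{n,r}(0)` generated by `T_1,…,T_{n-1}` is
isomorphic to the 0-Hecke algebra `H_n(0)` (which has dimension `n!` over `ℂ`), and
`H_{n,r}(0)` is free as a right module over this subalgebra with basis
`{ L_c : c ∈ C^n }`; in particular of rank `r^n`. -/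
theorem hecke_subalgebra_free (n r : ℕ) (hn : 1 ≤ n) (hr : 1 ≤ r)
    (u : Fin r → ℂ) (hu : Function.Injective u) :
    (∃ e : Hecke n ≃ₐ[ℂ] Algebra.adjoin ℂ (Set.range (Ti n r u 0)),
        ∀ i : Fin (n - 1), (e (hT n i) : AKSAlg n r u 0) = Ti n r u 0 i) ∧
    Module.finrank ℂ (Hecke n) = Nat.factorial n ∧
    (∀ a : AKSAlg n r u 0,
      ∃! b : (Fin n → Fin r) → Algebra.adjoin ℂ (Set.range (Ti n r u 0)),
        a = ∑ c : Fin n → Fin r, Lc n r u 0 c * (b c : AKSAlg n r u 0)) ∧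
    Fintype.card (Fin n → Fin r) = r ^ n := by
  have hmem (h : Hecke n) :
      heckeToAKS n r u h ∈ Algebra.adjoin ℂ (Set.range (Ti n r u 0)) :=
    range_heckeToAKS (u := u) ▸ ⟨h, rfl⟩
  refine ⟨⟨(AlgEquiv.ofInjective _ (heckeToAKS_injective hu hr)).trans
      (Subalgebra.equivOfEq _ _ range_heckeToAKS), heckeToAKS_hT⟩,
    finrank_hecke n hn, fun a => ?_, by simp⟩
  obtain ⟨b, hb⟩ := exists_eq_sum_Lc_mul hr hu a
  refine ⟨fun c => ⟨heckeToAKS n r u (b c), hmem _⟩, hb, fun b' hb' => ?_⟩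
  have hb'' (c) : ∃ h, heckeToAKS n r u h = b' c := by
    have hc : (b' c : AKSAlg n r u 0) ∈ (heckeToAKS n r u).range := by
      rw [range_heckeToAKS]
      exact (b' c).2
    exact hc
  choose h hh using hb''
  simp only [← hh] at hb'
  have hbh : h = b := by
    rw [← aksRep_sum_Lc_mul hu h, ← hb', hb, aksRep_sum_Lc_mul hu b]
  funext c
  exact Subtype.ext (by rw [← hh, hbh])

end AKS0
end
end
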